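/- For every integer N ≥ 3, the finite sum D_N(q) := ∑_{j=0}^{⌊N/2⌋} (−1)^j q^{j(3j+1−2N)/2} [N−j choose j]_q satisfies the recurrence D_N(q) = −q^{2−N} D_{N−3}(q), as an identity of Laurent polynomials in q. -/

import Mathlib

/-- Finite q-Pochhammer symbol `(z;q)_n`. -/
noncomputable def qp (z q : ℂ) (n : ℕ) : ℂ := ∏ r ∈ Finset.range n, (1 - z * q ^ r)

/-- Gaussian (q-binomial) coefficient `[M choose K]_q`. -/
noncomputable def qbinom (q : ℂ) (M K : ℕ) : ℂ :=
  if K ≤ M then qp q q M / (qp q q K * qp q q (M - K)) else 0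

/-- `D_N(q) = ∑_{j=0}^{⌊N/2⌋} (-1)^j q^{j(3j+1-2N)/2} [N-j choose j]_q`
(note `j(3j+1-2N)/2 = j(3j+1)/2 - jN`, where `j(3j+1)` is always even). -/
noncomputable def DD (q : ℂ) (N : ℕ) : ℂ :=
  ∑ j ∈ Finset.range (N / 2 + 1),
    (-1 : ℂ) ^ j * q ^ (((j * (3 * j + 1) / 2 : ℕ) : ℤ) - (j : ℤ) * (N : ℤ)) *
      qbinom q (N - j) j

theorem qp_succ (z q : ℂ) (n : ℕ) : qp z q (n + 1) = qp z q n * (1 - z * q ^ n) :=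
  Finset.prod_range_succ _ _

theorem qp_self_ne_zero {q : ℂ} (hq' : ∀ n : ℕ, 0 < n → q ^ n ≠ 1) (n : ℕ) :
    qp q q n ≠ 0 := by
  refine Finset.prod_ne_zero_iff.2 fun r _ => ?_
  rw [← pow_succ']
  exact sub_ne_zero.2 (hq' _ r.succ_pos).symm

theorem qbinom_zero_right {q : ℂ} (hq' : ∀ n : ℕ, 0 < n → q ^ n ≠ 1) (M : ℕ) :
    qbinom q M 0 = 1 := by
  have h := qp_self_ne_zero hq' M
  simpa [qbinom, qp] using h

theorem qbinom_self {q : ℂ} (hq' : ∀ n : ℕ, 0 < n → q ^ n ≠ 1) (M : ℕ) :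
    qbinom q M M = 1 := by
  have h := qp_self_ne_zero hq' M
  simpa [qbinom, qp] using h

theorem qbinom_of_lt (q : ℂ) {M K : ℕ} (h : M < K) : qbinom q M K = 0 :=
  if_neg h.not_ge

/-- Both `q`-Pascal rules. -/
theorem qbinom_succ_succ {q : ℂ} (hq' : ∀ n : ℕ, 0 < n → q ^ n ≠ 1) {M K : ℕ} (h : K ≤ M) :
    qbinom q (M + 1) (K + 1) = q ^ (K + 1) * qbinom q M (K + 1) + qbinom q M K ∧
    qbinom q (M + 1) (K + 1) = qbinom q M (K + 1) + q ^ (M - K) * qbinom q M K := by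
  rcases h.eq_or_lt with rfl | h
  · simp [qbinom_self hq', qbinom_of_lt q (Nat.lt_succ_self K)]
  · obtain ⟨d, rfl⟩ := Nat.exists_eq_add_of_lt h
    have hk := qp_self_ne_zero hq' K
    have hd := qp_self_ne_zero hq' d
    have hk' := qp_self_ne_zero hq' (K + 1)
    have hd' := qp_self_ne_zero hq' (d + 1)
    have e₁ : K + d + 1 + 1 - (K + 1) = d + 1 := by omega
    have e₂ : K + d + 1 - (K + 1) = d := by omega
    have e₃ : K + d + 1 - K = d + 1 := by omega
    simp only [qbinom, e₁, e₂, e₃, if_pos (show K + 1 ≤ K + d + 1 + 1 by omega),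
      if_pos (show K + 1 ≤ K + d + 1 by omega), if_pos (show K ≤ K + d + 1 by omega)]
    rw [qp_succ q q (K + d + 1), qp_succ q q K, qp_succ q q d]
    rw [qp_succ] at hk' hd'
    have hk₁ := right_ne_zero_of_mul hk'
    have hd₁ := right_ne_zero_of_mul hd'
    constructor <;> field_simp <;> ring

/-- The summand of `DD q N`, with an additional factor `q ^ (a * j)`. -/
noncomputable def ddTerm (q : ℂ) (a : ℤ) (N j : ℕ) : ℂ :=
  (-1 : ℂ) ^ j * q ^ (((j * (3 * j + 1) / 2 : ℕ) : ℤ) - (j : ℤ) * (N : ℤ) + a * j) *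
    qbinom q (N - j) j

theorem ddTerm_zero {q : ℂ} (hq' : ∀ n : ℕ, 0 < n → q ^ n ≠ 1) (a : ℤ) (N : ℕ) :
    ddTerm q a N 0 = 1 := by
  simp [ddTerm, qbinom_zero_right hq']

theorem DD_eq_sum_ddTerm (q : ℂ) {N n : ℕ} (h : N / 2 < n) :
    DD q N = ∑ j ∈ Finset.range n, ddTerm q 0 N j := by
  rw [← Finset.sum_subset (Finset.range_mono (Nat.succ_le_of_lt h))]
  · simp [DD, ddTerm]
  · intro j _ hj
    rw [Finset.mem_range] at hj
    rw [ddTerm, qbinom_of_lt q (by omega), mul_zero]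

theorem pentagonal_succ (j : ℕ) :
    (j + 1) * (3 * (j + 1) + 1) / 2 = j * (3 * j + 1) / 2 + (3 * j + 2) := by
  rw [show (j + 1) * (3 * (j + 1) + 1) = j * (3 * j + 1) + 2 * (3 * j + 2) by ring,
    Nat.add_mul_div_left _ _ two_pos]

theorem ddTerm_succ {q : ℂ} (hq : q ≠ 0) (hq' : ∀ n : ℕ, 0 < n → q ^ n ≠ 1)
    (a : ℤ) (m j : ℕ) :
    ddTerm q a (m + 2) (j + 1) =
      ddTerm q a (m + 1) (j + 1) - q ^ (a - m) * ddTerm q (a + 1) m j ∧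
    ddTerm q a (m + 2) (j + 1) =
      ddTerm q (a - 1) (m + 1) (j + 1) - q ^ a * ddTerm q (a - 1) m j := by
  have e₁ : m + 2 - (j + 1) = m + 1 - j := by omega
  have e₂ : m + 1 - (j + 1) = m - j := by omega
  simp only [ddTerm, e₁, e₂, pentagonal_succ]
  push_cast only [pow_succ]
  generalize j * (3 * j + 1) / 2 = p
  rcases lt_or_ge (m - j) j with h | h
  · simp [qbinom_of_lt q h, qbinom_of_lt q (show m - j < j + 1 by omega),
      qbinom_of_lt q (show m + 1 - j < j + 1 by omega)]
  · obtain ⟨d, rfl⟩ : ∃ d, m = 2 * j + d := ⟨m - 2 * j, by omega⟩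
    have e₃ : 2 * j + d + 1 - j = j + d + 1 := by omega
    have e₄ : 2 * j + d - j = j + d := by omega
    obtain ⟨h₁, h₂⟩ := qbinom_succ_succ hq' (Nat.le_add_right j d)
    rw [Nat.add_sub_cancel_left] at h₂
    rw [e₃, e₄]
    have hz (u v : ℤ) (x : ℂ) : q ^ u * (q ^ v * x) = q ^ (u + v) * x := by
      rw [← mul_assoc, ← zpow_add₀ hq]
    constructor
    · rw [h₁, ← zpow_natCast q (j + 1)]
      rw [mul_assoc, mul_add, hz, mul_assoc ((-1 : ℂ) ^ j) (q ^ _) (qbinom _ _ _),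
        mul_left_comm (q ^ _) ((-1 : ℂ) ^ j), hz]
      push_cast
      ring_nf
    · rw [h₂, ← zpow_natCast q d]
      rw [mul_assoc, mul_add, hz, mul_assoc ((-1 : ℂ) ^ j) (q ^ _) (qbinom _ _ _),
        mul_left_comm (q ^ _) ((-1 : ℂ) ^ j), hz]
      push_cast
      ring_nf

theorem sum_ddTerm_succ {q : ℂ} (hq : q ≠ 0) (hq' : ∀ n : ℕ, 0 < n → q ^ n ≠ 1)
    (a : ℤ) (m n : ℕ) :
    ∑ j ∈ Finset.range (n + 1), ddTerm q a (m + 2) j =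
      ∑ j ∈ Finset.range (n + 1), ddTerm q a (m + 1) j -
        q ^ (a - m) * ∑ j ∈ Finset.range n, ddTerm q (a + 1) m j ∧
    ∑ j ∈ Finset.range (n + 1), ddTerm q a (m + 2) j =
      ∑ j ∈ Finset.range (n + 1), ddTerm q (a - 1) (m + 1) j -
        q ^ a * ∑ j ∈ Finset.range n, ddTerm q (a - 1) m j := by
  simp only [Finset.sum_range_succ', ddTerm_zero hq', Finset.mul_sum]
  constructor
  · simp only [fun j => (ddTerm_succ hq hq' a m j).1, Finset.sum_sub_distrib]
    ring
  · simp only [fun j => (ddTerm_succ hq hq' a m j).2, Finset.sum_sub_distrib]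
    ring

theorem DD_add_four {q : ℂ} (hq : q ≠ 0) (hq' : ∀ n : ℕ, 0 < n → q ^ n ≠ 1) (k : ℕ) :
    DD q (k + 4) = DD q (k + 3) - q ^ (-(k : ℤ) - 2) * (DD q (k + 1) - q * DD q k) := by
  have h₁ := (sum_ddTerm_succ hq hq' 0 (k + 2) (k + 3)).1
  have h₂ := (sum_ddTerm_succ hq hq' 1 k (k + 2)).2
  rw [zero_add, h₂, sub_self, ← DD_eq_sum_ddTerm q (by omega), ← DD_eq_sum_ddTerm q (by omega),
    ← DD_eq_sum_ddTerm q (by omega), ← DD_eq_sum_ddTerm q (by omega), zpow_one] at h₁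
  rw [h₁]
  congr 3
  push_cast
  ring

theorem DD_zero (q : ℂ) : DD q 0 = 1 := by
  simp [DD, qbinom, qp]

theorem DD_three {q : ℂ} (hq : q ≠ 0) (hq' : ∀ n : ℕ, 0 < n → q ^ n ≠ 1) :
    DD q 3 = -q⁻¹ := by
  have h := (qbinom_succ_succ hq' (Nat.zero_le 1)).1
  rw [zero_add, qbinom_self hq', qbinom_zero_right hq'] at h
  simp [DD, Finset.sum_range_succ, qbinom_zero_right hq', h]
  field_simp
  ring

theorem DD_add_three {q : ℂ} (hq : q ≠ 0) (hq' : ∀ n : ℕ, 0 < n → q ^ n ≠ 1) (k : ℕ) :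
    DD q (k + 3) = -q ^ (-(k : ℤ) - 1) * DD q k := by
  induction k with
  | zero => simp [DD_zero, DD_three hq hq']
  | succ k ih =>
    have h : q ^ (-(k : ℤ) - 1) = q ^ (-(k : ℤ) - 2) * q := by
      rw [← zpow_add_one₀ hq]
      ring_nf
    rw [show k + 1 + 3 = k + 4 from rfl, DD_add_four hq hq', ih, h,
      show -((k + 1 : ℕ) : ℤ) - 1 = -(k : ℤ) - 2 by push_cast; ring]
    ring

/-- The recurrence `D_N(q) = -q^{2-N} D_{N-3}(q)` for `N ≥ 3`. -/
theorem stmt_13 (q : ℂ) (hq : q ≠ 0) (hq' : ∀ n : ℕ, 0 < n → q ^ n ≠ 1)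
    (N : ℕ) (hN : 3 ≤ N) :
    DD q N = -q ^ ((2 : ℤ) - (N : ℤ)) * DD q (N - 3) := by
  obtain ⟨k, rfl⟩ := Nat.exists_eq_add_of_le' hN
  rw [DD_add_three hq hq', Nat.add_sub_cancel,
    show (2 : ℤ) - ((k + 3 : ℕ) : ℤ) = -(k : ℤ) - 1 by push_cast; ring]
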